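/- For every number n ≥ 1 of agents all having the same normalized monotone valuation v on a finite set M of goods, there exists a complete EFX allocation of M, i.e., a partition ⟨X_1,…,X_n⟩ of M such that for all i, j and every g ∈ X_j we have v(X_i) ≥ v(X_j \ {g}). -/

import Mathlib

/-- For `n ≥ 1` agents sharing the same normalized monotone valuation `v` on a finite
set `M` of goods, a complete EFX allocation of `M` always exists. -/
theorem complete_efx_identical_valuations
    {G : Type} [DecidableEq G] (M : Finset G) (n : ℕ) (hn : 1 ≤ n)
    (v : Finset G → ℝ)
    (hnorm : v ∅ = 0)
    (hmono : ∀ S T : Finset G, S ⊆ T → v S ≤ v T) :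
    ∃ X : Fin n → Finset G,
      (∀ i j, i ≠ j → Disjoint (X i) (X j)) ∧
      Finset.univ.biUnion X = M ∧
      (∀ i j : Fin n, ∀ g ∈ X j, v (X j \ {g}) ≤ v (X i)) := by
  classical
  haveI : Nonempty (Fin n) := ⟨⟨0, hn⟩⟩
  let X : (M → Fin n) → Fin n → Finset G := fun f i => M.filter (fun x => ∃ h : x ∈ M, f ⟨x, h⟩ = i)
  have hX : ∀ f i x, x ∈ X f i ↔ ∃ h : x ∈ M, f ⟨x, h⟩ = i := by
    intro f i x
    simp only [X, Finset.mem_filter]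
    constructor
    · exact fun h => h.2
    · rintro ⟨h, e⟩
      exact ⟨h, h, e⟩
  let m : (M → Fin n) → ℝ := fun f => Finset.univ.inf' Finset.univ_nonempty (fun i => v (X f i))
  have hm : ∀ f i, m f ≤ v (X f i) := fun f i => Finset.inf'_le _ (Finset.mem_univ i)
  let A : (M → Fin n) → Finset (Fin n) := fun f => Finset.univ.filter (fun i => v (X f i) = m f)
  have hA : ∀ f i, i ∈ A f ↔ v (X f i) = m f := by intro f i; simp [A]
  let P : (M → Fin n) → ℝ ×ₗ (ℤ ×ₗ ℕ) := fun f =>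
    toLex (m f, toLex (-((A f).card : ℤ), ∑ i ∈ A f, (X f i).card))
  obtain ⟨f, -, hf⟩ := Finset.exists_max_image (Finset.univ : Finset (M → Fin n)) P
    Finset.univ_nonempty
  refine ⟨X f, ?_, ?_, ?_⟩
  · intro i j hij
    rw [Finset.disjoint_left]
    intro x hx hy
    rw [hX] at hx hy
    obtain ⟨h, e⟩ := hx
    obtain ⟨h', e'⟩ := hy
    exact hij (e.symm.trans e')
  · ext x
    simp only [Finset.mem_biUnion, hX, Finset.mem_univ, true_and]
    exact ⟨fun ⟨_, h, _⟩ => h, fun h => ⟨_, h, rfl⟩⟩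
  intro i₀ j g hg
  by_contra! hlt
  obtain ⟨i, -, hi⟩ := Finset.exists_mem_eq_inf' (Finset.univ_nonempty (α := Fin n))
    (fun i => v (X f i))
  change m f = v (X f i) at hi
  have hj : m f < v (X f j \ {g}) := (hm f i₀).trans_lt hlt
  have hjA : m f < v (X f j) := hj.trans_le (hmono _ _ Finset.sdiff_subset)
  have hij : i ≠ j := by rintro rfl; linarith
  obtain ⟨hgM, hgj⟩ := (hX _ _ _).1 hg
  let f' := Function.update f ⟨g, hgM⟩ i
  have hgi : g ∉ X f i := by
    intro h
    obtain ⟨_, e⟩ := (hX _ _ _).1 h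
    exact hij (e.symm.trans hgj)
  have Xi : X f' i = insert g (X f i) := by
    ext x
    simp only [Finset.mem_insert, hX, f', Function.update_apply, Subtype.mk.injEq]
    by_cases hx : x = g
    · subst hx; simp [hgM]
    · simp [hx]
  have Xj : X f' j = X f j \ {g} := by
    ext x
    simp only [Finset.mem_sdiff, Finset.mem_singleton, hX, f', Function.update_apply, Subtype.mk.injEq]
    by_cases hx : x = g
    · subst hx; simp [hij]
    · simp [hx]
  have Xk : ∀ k, k ≠ i → k ≠ j → X f' k = X f k := by
    intro k hki hkj
    ext x
    simp only [hX, f', Function.update_apply, Subtype.mk.injEq]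
    by_cases hx : x = g
    · subst hx; simp [hgM, hki.symm, hgj, hkj.symm]
    · simp [hx]
  have hvi : v (X f i) ≤ v (X f' i) := by
    rw [Xi]; exact hmono _ _ (Finset.subset_insert _ _)
  have hmm : m f ≤ m f' := by
    refine Finset.le_inf' _ _ fun k _ => ?_
    by_cases hki : k = i
    · subst hki; exact (hm f k).trans hvi
    by_cases hkj : k = j
    · subst hkj; rw [Xj]; exact hj.le
    · rw [Xk k hki hkj]; exact hm f k
  have key : P f < P f' := by
    rcases hmm.lt_or_eq with h | h
    · exact Prod.Lex.toLex_lt_toLex.2 (Or.inl h)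
    refine Prod.Lex.toLex_lt_toLex.2 (Or.inr ⟨h, ?_⟩)
    have hsub : A f' ⊆ A f := by
      intro k hk
      rw [hA] at hk ⊢
      rw [← h] at hk
      by_cases hki : k = i
      · rw [hki]; exact hi.symm
      by_cases hkj : k = j
      · subst hkj; rw [Xj] at hk; linarith
      · rwa [Xk k hki hkj] at hk
    rcases hsub.eq_or_ssubset with e | e
    · refine Prod.Lex.toLex_lt_toLex.2 (Or.inr ⟨by simp [e], ?_⟩)
      simp only [e]
      have hcard : (X f i).card < (X f' i).card := by
        rw [Xi, Finset.card_insert_of_notMem hgi]; omega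
      refine Finset.sum_lt_sum (fun k hk => ?_) ⟨i, (hA _ _).2 hi.symm, hcard⟩
      by_cases hki : k = i
      · subst hki; exact hcard.le
      have hkj : k ≠ j := by
        rintro rfl
        rw [hA] at hk; linarith
      rw [Xk k hki hkj]
    · refine Prod.Lex.toLex_lt_toLex.2 (Or.inl ?_)
      have := Finset.card_lt_card e
      simp only []
      omega
  exact absurd (hf f' (Finset.mem_univ _)) (not_le.2 key)
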